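/- arXiv:2202.03604 — 4 statements merged into one kernel-verified Lean document; each statement's English description precedes it below -/
import Mathlib

section
/- Let R be a commutative Noetherian ring. Then the canonical R-algebra map from R to the product, over all maximal ideals 𝔪 of R, of the 𝔪-adic completions R^∧_𝔪 of R, is faithfully flat; that is, ∏_{𝔪 maximal} R^∧_𝔪 is a faithfully flat R-module. -/
/-- A product of flat modules over a Noetherian ring is flat. -/
theorem Module.Flat.pi_of_isNoetherianRing {R ι : Type*} [CommRing R] [IsNoetherianRing R]
    (M : ι → Type*) [∀ i, AddCommGroup (M i)] [∀ i, Module R (M i)] [∀ i, Module.Flat R (M i)] :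
    Module.Flat R (Π i, M i) := by
  refine Module.Flat.of_forall_isTrivialRelation fun {l f x} hfx ↦ ?_
  obtain ⟨k, g, hg⟩ := Submodule.fg_iff_exists_fin_generating_family.mp
    (IsNoetherian.noetherian (LinearMap.ker (Fintype.linearCombination R f)))
  have hker (i : ι) : ∃ y : Fin k → M i, ∀ s, x s i = ∑ t, g t s • y t := by
    obtain ⟨k', a, y, hx, ha⟩ := Module.Flat.isTrivialRelation_of_sum_smul_eq_zero
      (f := f) (x := fun s ↦ x s i) (by simpa using congrFun hfx i)
    have hspan (j : Fin k') : ∃ c : Fin k → R, ∑ t, c t • g t = fun s ↦ a s j := by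
      rw [← Submodule.mem_span_range_iff_exists_fun, hg, LinearMap.mem_ker,
        Fintype.linearCombination_apply]
      simpa [mul_comm] using ha j
    choose c hc using hspan
    refine ⟨fun t ↦ ∑ j, c j t • y j, fun s ↦ ?_⟩
    have hc' (j : Fin k') : a s j = ∑ t, c j t * g t s := by
      simpa using (congrFun (hc j) s).symm
    simp only [hx, hc', Finset.sum_smul, Finset.smul_sum, smul_smul]
    rw [Finset.sum_comm]
    simp only [mul_comm]
  choose y hy using hker
  refine ⟨k, fun s t ↦ g t s, fun t i ↦ y i t, fun s ↦ ?_, fun t ↦ ?_⟩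
  · ext i
    simpa using hy i s
  · have hgt : g t ∈ LinearMap.ker (Fintype.linearCombination R f) :=
      hg ▸ Submodule.subset_span ⟨t, rfl⟩
    simpa [Fintype.linearCombination_apply, mul_comm] using hgt

/-- A module with a surjection onto `R ⧸ I` for a proper ideal `I` is not equal to `I` times
itself. -/
theorem Ideal.smul_top_ne_top_of_surjective {R M : Type*} [CommRing R] [AddCommGroup M]
    [Module R M] {I : Ideal R} (hI : I ≠ ⊤) (f : M →ₗ[R] R ⧸ I) (hf : Function.Surjective f) :
    I • (⊤ : Submodule R M) ≠ ⊤ := by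
  intro h
  have hle : I • (⊤ : Submodule R M) ≤ LinearMap.ker f := by
    refine Submodule.smul_le.mpr fun r hr x _ ↦ ?_
    obtain ⟨z, hz⟩ := Ideal.Quotient.mk_surjective (f x)
    rw [LinearMap.mem_ker, map_smul, ← hz, Algebra.smul_def, Ideal.Quotient.algebraMap_eq,
      Ideal.Quotient.eq_zero_iff_mem.mpr hr, zero_mul]
  have := Ideal.Quotient.nontrivial_iff.mpr hI
  obtain ⟨x, hx⟩ := hf 1
  exact one_ne_zero (hx.symm.trans (hle (h.ge Submodule.mem_top)))

/-- For a commutative Noetherian ring `R`, the product over all maximal ideals `𝔪` of `R`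
of the `𝔪`-adic completions of `R` is a faithfully flat `R`-module (equivalently, the
canonical ring map from `R` to this product is faithfully flat). -/
theorem faithfullyFlat_pi_adicCompletion_maximal
    (R : Type*) [CommRing R] [IsNoetherianRing R] :
    Module.FaithfullyFlat R
      (Π 𝔪 : MaximalSpectrum R, AdicCompletion 𝔪.asIdeal R) := by
  have := Module.Flat.pi_of_isNoetherianRing (R := R)
    fun 𝔪 : MaximalSpectrum R ↦ AdicCompletion 𝔪.asIdeal R
  refine ⟨fun m hm ↦ ?_⟩
  let 𝔪 : MaximalSpectrum R := ⟨m, hm⟩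
  exact Ideal.smul_top_ne_top_of_surjective hm.ne_top
    ((AdicCompletion.evalOneₐ m).toLinearMap ∘ₗ
      LinearMap.proj (φ := fun 𝔪 : MaximalSpectrum R ↦ AdicCompletion 𝔪.asIdeal R) 𝔪)
    ((AdicCompletion.evalOneₐ_surjective m).comp (Function.surjective_eval 𝔪))
end

section
/- Let k be a perfect field of characteristic p > 0 and let R be a smooth k-algebra. For f ∈ R, the differential d f vanishes in the module of Kähler differentials Ω_{R/k} if and only if f = g^p for some g ∈ R. -/
universe u

open TensorProduct

section PthPower

/-- A finite unramified extension of rings of characteristic `p` containing all `p`-th powers in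
the base is trivial. -/
theorem Algebra.FormallyUnramified.surjective_algebraMap_of_pow_mem_range
    {B S : Type*} [CommRing B] [CommRing S] [Algebra B S] (p : ℕ) [Fact p.Prime] [CharP B p]
    [Module.Finite B S] [Algebra.FormallyUnramified B S]
    (h : ∀ s : S, s ^ p ∈ (algebraMap B S).range) :
    Function.Surjective (algebraMap B S) := by
  rw [← Algebra.isEpi_iff_surjective_algebraMap_of_finite, Algebra.isEpi_iff_forall_one_tmul_eq]
  obtain ⟨t, ht, ht1⟩ := Algebra.FormallyUnramified.iff_exists_tensorProduct.mp
    (inferInstance : Algebra.FormallyUnramified B S)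
  have hp : (p : S ⊗[B] S) = 0 := by
    rw [← map_natCast (algebraMap B (S ⊗[B] S)), CharP.cast_eq_zero, map_zero]
  have hle : KaehlerDifferential.ideal B S ≤ nilradical (S ⊗[B] S) := by
    rw [← KaehlerDifferential.span_range_eq_ideal, Ideal.span_le]
    rintro _ ⟨s, rfl⟩
    rcases subsingleton_or_nontrivial (S ⊗[B] S) with _ | _
    · rw [Subsingleton.elim (nilradical (S ⊗[B] S)) ⊤]
      trivial
    have : CharP (S ⊗[B] S) p :=
      (CharP.charP_iff_prime_eq_zero Fact.out).mpr hp
    refine ⟨p, ?_⟩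
    obtain ⟨b, hb⟩ := h s
    rw [sub_pow_char, Algebra.TensorProduct.tmul_pow, Algebra.TensorProduct.tmul_pow, one_pow,
      ← hb, Algebra.algebraMap_eq_smul_one, TensorProduct.tmul_smul, TensorProduct.smul_tmul',
      sub_self]
    rfl
  have hu : IsUnit t := by
    have : IsNilpotent (1 - t) := hle (by
      rw [KaehlerDifferential.ideal, RingHom.mem_ker, map_sub, map_one, sub_eq_zero]
      exact ht1.symm)
    simpa using this.isUnit_one_sub
  intro s
  exact sub_eq_zero.mp ((hu.mul_left_eq_zero).mp (ht s))

theorem Derivation.iterate_mul_pow {k S : Type*} [CommRing k] [CommRing S] [Algebra k S]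
    (δ : Derivation k S S) {b x : S} (hb : δ b = 0) (hx : δ x = 1) (m n : ℕ) :
    δ^[n] (b * x ^ m) = b * m.descFactorial n * x ^ (m - n) := by
  induction n with
  | zero => simp
  | succ n ih =>
    rw [Function.iterate_succ_apply', ih, Nat.descFactorial_succ, Nat.sub_succ']
    simp only [Derivation.leibniz, Derivation.leibniz_pow, Derivation.map_natCast, hb, hx,
      smul_eq_mul, nsmul_eq_mul]
    push_cast
    ring

theorem Derivation.iterate_sum {k S ι : Type*} [CommRing k] [CommRing S] [Algebra k S]
    (δ : Derivation k S S) (n : ℕ) (s : Finset ι) (g : ι → S) :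
    δ^[n] (∑ i ∈ s, g i) = ∑ i ∈ s, δ^[n] (g i) := by
  have := map_sum ((δ : S →ₗ[k] S) ^ n) g s
  simp only [Module.End.pow_apply] at this
  exact this

/-- If a derivation kills a subalgebra `B` containing `x ^ p` and maps `x` to `1`, then its kernel
on `B[x]` is `B`. -/
theorem Derivation.mem_of_mem_adjoin_singleton {k S : Type*} [Field k] [CommRing S] [Algebra k S]
    (p : ℕ) [Fact p.Prime] [CharP k p] (δ : Derivation k S S) (B : Subalgebra k S)
    (hB : ∀ b ∈ B, δ b = 0) {x f : S} (hx : δ x = 1) (hxp : x ^ p ∈ B)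
    (hf : f ∈ Algebra.adjoin B {x}) (hδ : δ f = 0) : f ∈ B := by
  have hp : p.Prime := Fact.out
  have key (b : S) (hb : b ∈ B) (m : ℕ) : δ^[p - 1] (b * x ^ m) ∈ B := by
    have hb' : b * (x ^ p) ^ (m / p) ∈ B := mul_mem hb (pow_mem hxp _)
    have hm : m % p - (p - 1) = 0 := by have := Nat.mod_lt m hp.pos; omega
    have : b * x ^ m = b * (x ^ p) ^ (m / p) * x ^ (m % p) := by
      rw [mul_assoc, ← pow_mul, ← pow_add, Nat.div_add_mod]
    rw [this, δ.iterate_mul_pow (hB _ hb') hx, hm, pow_zero, mul_one]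
    exact mul_mem hb' (natCast_mem B _)
  have hmem : δ^[p - 1] (f * x ^ (p - 1)) ∈ B := by
    rw [Algebra.adjoin_singleton_eq_range_aeval] at hf
    obtain ⟨q, rfl⟩ := hf
    change δ^[p - 1] (Polynomial.aeval x q * x ^ (p - 1)) ∈ B
    rw [Polynomial.aeval_eq_sum_range, Finset.sum_mul, δ.iterate_sum]
    refine sum_mem fun i _ ↦ ?_
    rw [Algebra.smul_def, mul_assoc, ← pow_add]
    exact key _ (q.coeff i).2 _
  rw [δ.iterate_mul_pow hδ hx, Nat.sub_self, pow_zero, mul_one, Nat.descFactorial_self] at hmem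
  have hfac : ((p - 1).factorial : k) ≠ 0 := by
    rw [Ne, CharP.cast_eq_zero_iff k p, hp.dvd_factorial]
    have := hp.pos
    omega
  have : f = ((p - 1).factorial : k)⁻¹ • (f * ((p - 1).factorial : S)) := by
    rw [mul_comm, ← _root_.map_natCast (algebraMap k S), ← Algebra.smul_def, smul_smul,
      inv_mul_cancel₀ hfac, one_smul]
  rw [this]
  exact B.smul_mem hmem _

theorem Derivation.mem_adjoin_range_pow {k S ι : Type*} [Field k] [CommRing S] [Algebra k S]
    (p : ℕ) [Fact p.Prime] [CharP k p] (x : ι → S) (δ : ι → Derivation k S S)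
    (hδ : ∀ i, δ i (x i) = 1) (hδ' : ∀ i j, i ≠ j → δ i (x j) = 0) (s : Finset ι) (f : S)
    (hf : f ∈ Algebra.adjoin k (Set.range (fun a : S ↦ a ^ p) ∪ x '' s))
    (h : ∀ i, δ i f = 0) : f ∈ Algebra.adjoin k (Set.range (fun a : S ↦ a ^ p)) := by
  classical
  induction s using Finset.induction_on with
  | empty => simpa using hf
  | insert i s hi ih =>
    refine ih ?_
    rw [Finset.coe_insert, Set.image_insert_eq, Set.insert_eq, Set.union_comm {x i},
      ← Set.union_assoc, Algebra.adjoin_union_eq_adjoin_adjoin] at hf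
    refine (δ i).mem_of_mem_adjoin_singleton p _ (fun b hb ↦ ?_) (hδ i)
      (Algebra.subset_adjoin (Or.inl ⟨_, rfl⟩)) hf (h i)
    have hp : (p : S) = 0 := by
      rw [← _root_.map_natCast (algebraMap k S), CharP.cast_eq_zero, map_zero]
    induction hb using Algebra.adjoin_induction with
    | mem y hy =>
      rcases hy with ⟨a, rfl⟩ | ⟨j, hj, rfl⟩
      · simp [Derivation.leibniz_pow, ← Nat.cast_smul_eq_nsmul S, hp]
      · exact hδ' i j (by rintro rfl; exact hi hj)
    | algebraMap r => simp
    | add a b _ _ ha hb => simp [ha, hb]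
    | mul a b _ _ ha hb => simp [ha, hb]

theorem adjoin_range_pow_union_eq_top {k S ι : Type*} [Field k] [CommRing S] [Algebra k S]
    (p : ℕ) [Fact p.Prime] [CharP k p] [Nontrivial S] [Algebra.FiniteType k S] (x : ι → S)
    (hx : Submodule.span S (Set.range fun i ↦ KaehlerDifferential.D k S (x i)) = ⊤) :
    Algebra.adjoin k (Set.range (fun a : S ↦ a ^ p) ∪ Set.range x) = ⊤ := by
  set B := Algebra.adjoin k (Set.range (fun a : S ↦ a ^ p) ∪ Set.range x)
  have hpow (a : S) : a ^ p ∈ B := Algebra.subset_adjoin (Or.inl ⟨a, rfl⟩)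
  have : CharP B p := charP_of_injective_algebraMap (algebraMap k B).injective p
  have : Algebra.FiniteType B S := .of_restrictScalars_finiteType k B S
  have : Algebra.IsIntegral B S := ⟨fun a ↦
    .of_pow (Fact.out : p.Prime).pos (isIntegral_algebraMap (x := (⟨a ^ p, hpow a⟩ : B)))⟩
  have : Module.Finite B S := Algebra.IsIntegral.finite
  have : Algebra.FormallyUnramified B S := by
    refine ⟨?_⟩
    rw [← Submodule.subsingleton_iff S, ← subsingleton_iff_bot_eq_top, eq_comm,
      ← LinearMap.range_eq_top.mpr (KaehlerDifferential.map_surjective k B S),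
      LinearMap.range_eq_map, ← hx, Submodule.map_span, Submodule.span_eq_bot]
    rintro _ ⟨_, ⟨i, rfl⟩, rfl⟩
    rw [KaehlerDifferential.map_D]
    exact (KaehlerDifferential.D B S).map_algebraMap
      ⟨x i, Algebra.subset_adjoin (Or.inr ⟨i, rfl⟩)⟩
  rw [Algebra.eq_top_iff]
  intro s
  obtain ⟨b, rfl⟩ :=
    Algebra.FormallyUnramified.surjective_algebraMap_of_pow_mem_range (B := B) p
      (fun s ↦ ⟨⟨s ^ p, hpow s⟩, rfl⟩) s
  exact b.2

theorem exists_pow_eq_of_mem_adjoin_range_pow {k S : Type*} [Field k] [CommRing S] [Algebra k S]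
    (p : ℕ) [Fact p.Prime] [CharP k p] [CharP S p] [PerfectField k] {f : S}
    (hf : f ∈ Algebra.adjoin k (Set.range (fun a : S ↦ a ^ p))) : ∃ g : S, f = g ^ p := by
  have : PerfectRing k p := PerfectField.toPerfectRing p
  induction hf using Algebra.adjoin_induction with
  | mem y hy => exact hy.imp fun _ h ↦ h.symm
  | algebraMap r =>
    obtain ⟨c, rfl⟩ := surjective_frobenius k p r
    exact ⟨algebraMap k S c, by rw [frobenius_def, map_pow]⟩
  | add a b _ _ ha hb =>
    obtain ⟨a, rfl⟩ := ha
    obtain ⟨b, rfl⟩ := hb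
    exact ⟨a + b, (add_pow_char a b p).symm⟩
  | mul a b _ _ ha hb =>
    obtain ⟨a, rfl⟩ := ha
    obtain ⟨b, rfl⟩ := hb
    exact ⟨a * b, (mul_pow a b p).symm⟩

theorem exists_pow_eq_of_D_eq_zero_of_basis {k S ι : Type*} [Field k] [CommRing S] [Algebra k S]
    (p : ℕ) [Fact p.Prime] [CharP k p] [PerfectField k] [Algebra.FiniteType k S]
    (b : Module.Basis ι S Ω[S⁄k]) (hb : Set.range b ⊆ Set.range (KaehlerDifferential.D k S))
    {f : S} (hf : KaehlerDifferential.D k S f = 0) : ∃ g : S, f = g ^ p := by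
  classical
  rcases subsingleton_or_nontrivial S with _ | _
  · exact ⟨0, Subsingleton.elim _ _⟩
  have : CharP S p := charP_of_injective_algebraMap (algebraMap k S).injective p
  have : Finite ι := Module.Finite.finite_basis b
  have := Fintype.ofFinite ι
  choose x hx using fun i ↦ hb ⟨i, rfl⟩
  have htop := adjoin_range_pow_union_eq_top p x (k := k) (by
    simpa only [hx] using b.span_eq)
  refine exists_pow_eq_of_mem_adjoin_range_pow (k := k) p <|
    Derivation.mem_adjoin_range_pow p x (fun i ↦ (b.coord i).compDer (KaehlerDifferential.D k S))
      (fun i ↦ by simp [hx]) (fun i j hij ↦ by simp [hx, hij.symm]) Finset.univ f ?_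
      (fun i ↦ by simp [hf])
  simp [htop]

/-- The ideal of elements `a` such that `a ^ p * f` is a `p`-th power. -/
def pthPowerIdeal {R : Type*} [CommRing R] (p : ℕ) [Fact p.Prime] [CharP R p] (f : R) :
    Ideal R where
  carrier := {a | ∃ g, a ^ p * f = g ^ p}
  add_mem' := by
    rintro a b ⟨g, hg⟩ ⟨h, hh⟩
    exact ⟨g + h, by rw [add_pow_char, add_pow_char, add_mul, hg, hh]⟩
  zero_mem' := ⟨0, by simp [(Fact.out : p.Prime).ne_zero]⟩
  smul_mem' := by
    rintro c a ⟨g, hg⟩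
    exact ⟨c * g, by rw [smul_eq_mul, mul_pow, mul_pow, mul_assoc, hg]⟩

theorem mem_radical_pthPowerIdeal {R : Type*} [CommRing R] (p : ℕ) [Fact p.Prime] [CharP R p]
    (f a : R) (h : ∃ g : Localization.Away a, algebraMap R _ f = g ^ p) :
    a ∈ (pthPowerIdeal p f).radical := by
  obtain ⟨g, hg⟩ := h
  obtain ⟨n, r, hr⟩ := IsLocalization.Away.surj a g
  have : algebraMap R (Localization.Away a) ((a ^ n) ^ p * f) =
      algebraMap R (Localization.Away a) (r ^ p) := by
    rw [map_mul, hg, map_pow, map_pow, map_pow, ← hr]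
    ring
  obtain ⟨m, hm⟩ := IsLocalization.Away.exists_of_eq a this
  refine ⟨n + m, a ^ m * r, ?_⟩
  obtain ⟨q, hq⟩ := Nat.exists_eq_succ_of_ne_zero (Fact.out : p.Prime).ne_zero
  calc (a ^ (n + m)) ^ p * f = (a ^ m) ^ q * (a ^ m * ((a ^ n) ^ p * f)) := by
        rw [hq, Nat.succ_eq_add_one]; ring
    _ = (a ^ m * r) ^ p := by rw [hm, hq, Nat.succ_eq_add_one]; ring

end PthPower

/-- Let `k` be a perfect field of characteristic `p > 0` and `R` a smooth `k`-algebra.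
For `f ∈ R`, the differential `d f` vanishes in the module of Kähler differentials
`Ω[R⁄k]` if and only if `f` is a `p`-th power in `R`. -/
theorem kaehlerDifferential_D_eq_zero_iff_isPthPower
    (p : ℕ) [hp : Fact p.Prime]
    (k : Type u) [Field k] [CharP k p] [PerfectField k]
    (R : Type u) [CommRing R] [Algebra k R] [Algebra.Smooth k R]
    (f : R) :
    KaehlerDifferential.D k R f = 0 ↔ ∃ g : R, f = g ^ p := by
  rcases subsingleton_or_nontrivial R with _ | _
  · exact ⟨fun _ ↦ ⟨0, Subsingleton.elim _ _⟩, fun _ ↦ by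
      rw [Subsingleton.elim f 0, map_zero]⟩
  have : CharP R p := charP_of_injective_algebraMap (algebraMap k R).injective p
  constructor
  · intro hf
    obtain ⟨s, hs, hsm⟩ := Algebra.Smooth.exists_span_eq_top_isStandardSmooth k (S := R)
    have hrad : (pthPowerIdeal p f).radical = ⊤ := by
      rw [← top_le_iff, ← hs, Ideal.span_le]
      intro a ha
      have := hsm a ha
      obtain ⟨-, I, b, hb⟩ :=
        Algebra.IsStandardSmooth.iff_exists_basis_kaehlerDifferential.mp this
      refine mem_radical_pthPowerIdeal p f a (exists_pow_eq_of_D_eq_zero_of_basis p b hb ?_)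
      rw [← KaehlerDifferential.map_D k k R, hf, map_zero]
    obtain ⟨g, hg⟩ : (1 : R) ∈ pthPowerIdeal p f :=
      (Ideal.eq_top_iff_one _).mp (Ideal.radical_eq_top.mp hrad)
    exact ⟨g, by rwa [one_pow, one_mul] at hg⟩
  · rintro ⟨g, rfl⟩
    rw [Derivation.leibniz_pow, ← Nat.cast_smul_eq_nsmul R, CharP.cast_eq_zero, zero_smul]
end

section
/- Let S be a Noetherian integral domain of characteristic zero which is p-adically complete, in which p ≠ 0 and the principal ideal pS is prime. Let 𝔬_L denote the p-adic completion of the localization of S at the prime ideal pS (a complete discrete valuation ring with uniformizer p), and let L = 𝔬_L[1/p]. Then, inside the ring 𝔬_L((t))^∧_(p)[1/p], one has the equality of subrings S((t))^∧_(p)[1/p] ∩ 𝔬_L⟦t⟧[1/p] = S⟦t⟧[1/p]. -/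
/-!
Statement 7: Let `S` be a Noetherian integral domain of characteristic zero which is
`p`-adically complete, with `p ≠ 0` and `pS` prime.  Let `𝔬_L` be the `p`-adic
completion of the localization of `S` at `pS`.  Then, inside `𝔬_L((t))^∧_(p)[1/p]`,
one has `S((t))^∧_(p)[1/p] ∩ 𝔬_L⟦t⟧[1/p] = S⟦t⟧[1/p]`.
-/

open PowerSeries

/-- The `p`-adic completion of the Laurent series ring `R((t))`. -/
noncomputable abbrev PCLS (p : ℕ) (R : Type) [CommRing R] : Type :=
  AdicCompletion (Ideal.span {(p : LaurentSeries R)}) (LaurentSeries R)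

/-- The ring `R⟦t⟧[1/p]`. -/
noncomputable abbrev PSLoc (p : ℕ) (R : Type) [CommRing R] : Type :=
  Localization.Away (p : PowerSeries R)

/-- The ring `R((t))^∧_(p)[1/p]`. -/
noncomputable abbrev LSLoc (p : ℕ) (R : Type) [CommRing R] : Type :=
  Localization.Away (p : PCLS p R)

/-- The `p`-adic completion `𝔬_L` of the localization of `S` at the prime ideal `pS`. -/
noncomputable abbrev OL (p : ℕ) (S : Type) [CommRing S]
    [(Ideal.span {(p : S)}).IsPrime] : Type :=
  AdicCompletion
    (Ideal.span {(p : Localization.AtPrime (Ideal.span {(p : S)}))})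
    (Localization.AtPrime (Ideal.span {(p : S)}))

theorem AdicCompletion.evalₐ_eq_zero_of_cast_pow_dvd {R : Type*} [CommRing R] {q n : ℕ}
    {x : AdicCompletion (Ideal.span {(q : R)}) R}
    (h : (q : AdicCompletion (Ideal.span {(q : R)}) R) ^ n ∣ x) :
    AdicCompletion.evalₐ (Ideal.span {(q : R)}) n x = 0 := by
  obtain ⟨y, rfl⟩ := h
  have hq : ((q : R ⧸ Ideal.span {(q : R)} ^ n)) ^ n = 0 := by
    have h := Ideal.Quotient.eq_zero_iff_mem.mpr
      (Ideal.pow_mem_pow (Ideal.mem_span_singleton_self (q : R)) n)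
    rwa [map_pow, map_natCast] at h
  rw [map_mul, map_pow, map_natCast, hq, zero_mul]

theorem AdicCompletion.cast_pow_dvd_of_cast_pow_dvd_algebraMap {R : Type*} [CommRing R]
    {q n : ℕ} {r : R} (h : (q : AdicCompletion (Ideal.span {(q : R)}) R) ^ n ∣
      algebraMap R (AdicCompletion (Ideal.span {(q : R)}) R) r) : (q : R) ^ n ∣ r := by
  have h' := AdicCompletion.evalₐ_eq_zero_of_cast_pow_dvd h
  rwa [AlgHom.commutes, Ideal.Quotient.algebraMap_eq, Ideal.Quotient.eq_zero_iff_mem,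
    Ideal.span_singleton_pow, Ideal.mem_span_singleton] at h'

theorem AdicCompletion.eq_zero_of_forall_cast_pow_dvd {R : Type*} [CommRing R] {q : ℕ}
    {x : AdicCompletion (Ideal.span {(q : R)}) R}
    (h : ∀ n, (q : AdicCompletion (Ideal.span {(q : R)}) R) ^ n ∣ x) : x = 0 := by
  refine AdicCompletion.ext_evalₐ fun n => ?_
  rw [AdicCompletion.evalₐ_eq_zero_of_cast_pow_dvd (h n), _root_.map_zero]

theorem AdicCompletion.exists_cast_pow_dvd_sub_algebraMap {R : Type*} [CommRing R] {q : ℕ}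
    (x : AdicCompletion (Ideal.span {(q : R)}) R) (n : ℕ) :
    ∃ r : R, (q : AdicCompletion (Ideal.span {(q : R)}) R) ^ n ∣ x - algebraMap R _ r := by
  obtain ⟨r, hr⟩ := Submodule.Quotient.mk_surjective _ (x.val n)
  refine ⟨r, ?_⟩
  have hmem : x - algebraMap R _ r ∈
      (AdicCompletion.eval (Ideal.span {(q : R)}) R n).ker := by
    rw [LinearMap.mem_ker, map_sub, sub_eq_zero]
    exact hr.symm
  rw [← AdicCompletion.pow_smul_top_eq_ker_eval (Submodule.fg_span_singleton _),
    Ideal.span_singleton_pow, Submodule.ideal_span_singleton_smul] at hmem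
  obtain ⟨y, -, hy⟩ := (Submodule.mem_smul_pointwise_iff_exists _ _ _).mp hmem
  refine ⟨y, ?_⟩
  rw [← hy, Algebra.smul_def, map_pow, map_natCast]

/-- If `a` is prime, the powers of `a` dividing an element do not grow upon localizing
at `(a)`. -/
theorem IsLocalization.AtPrime.pow_dvd_of_pow_dvd_algebraMap {R A : Type*} [CommRing R]
    [IsDomain R] {a : R} (ha : Prime a) [(Ideal.span {a}).IsPrime] [CommRing A] [Algebra R A]
    [IsLocalization.AtPrime A (Ideal.span {a})] {n : ℕ} {r : R}
    (h : algebraMap R A a ^ n ∣ algebraMap R A r) : a ^ n ∣ r := by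
  obtain ⟨z, hz⟩ := h
  obtain ⟨⟨b, u⟩, hu⟩ := IsLocalization.surj (Ideal.span {a}).primeCompl z
  have hinj : Function.Injective (algebraMap R A) :=
    IsLocalization.injective A (Ideal.span {a}).primeCompl_le_nonZeroDivisors
  have hmul : (u : R) * r = a ^ n * b := by
    apply hinj
    rw [map_mul, map_mul, map_pow, hz, ← hu]
    ring
  exact ha.pow_dvd_of_dvd_mul_left n (fun hd => u.2 (Ideal.mem_span_singleton.mpr hd))
    ⟨b, hmul⟩

theorem HahnSeries.cast_pow_dvd_coeff {R : Type*} [CommRing R] {q n : ℕ}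
    {x : LaurentSeries R} (h : (q : LaurentSeries R) ^ n ∣ x) (k : ℤ) :
    (q : R) ^ n ∣ x.coeff k := by
  obtain ⟨y, rfl⟩ := h
  refine ⟨y.coeff k, ?_⟩
  rw [← Nat.cast_pow, ← Nat.cast_pow, ← nsmul_eq_mul, ← nsmul_eq_mul]
  exact map_nsmul (HahnSeries.coeff.addMonoidHom k) _ _

/-- In a `q`-adically complete ring, an element of an overring in which `q`-divisibility of
elements of the base is unchanged lies in the base as soon as it is a `q`-adic limit of
elements of the base. -/
theorem IsPrecomplete.exists_map_eq_of_forall_cast_pow_dvd {R O : Type*} [CommRing R]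
    [CommRing O] {q : ℕ} (hR : IsPrecomplete (Ideal.span {(q : R)}) R) (ι : R →+* O)
    (hι : ∀ (n : ℕ) (r : R), (q : O) ^ n ∣ ι r → (q : R) ^ n ∣ r)
    (hO : ∀ x : O, (∀ n : ℕ, (q : O) ^ n ∣ x) → x = 0) {y : O}
    (hy : ∀ n : ℕ, ∃ r : R, (q : O) ^ n ∣ y - ι r) : ∃ r, ι r = y := by
  have hmod (n : ℕ) (a b : R) :
      a ≡ b [SMOD (Ideal.span {(q : R)} ^ n • ⊤ : Submodule R R)] ↔ (q : R) ^ n ∣ a - b := by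
    rw [SModEq.sub_mem, smul_eq_mul, Ideal.mul_top, Ideal.span_singleton_pow,
      Ideal.mem_span_singleton]
  choose r hr using hy
  obtain ⟨s, hs⟩ := hR.prec' r fun {m n} hmn => (hmod m _ _).mpr <| hι m _ <| by
    have h := dvd_sub ((pow_dvd_pow (q : O) hmn).trans (hr n)) (hr m)
    rwa [sub_sub_sub_cancel_left, ← map_sub] at h
  refine ⟨s, (sub_eq_zero.mp (hO _ fun n => ?_)).symm⟩
  have h := map_dvd ι ((hmod n _ _).mp (hs n))
  rw [map_pow, map_natCast, map_sub] at h
  simpa using dvd_add (hr n) h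

theorem powerSeriesLoc_eq_inter_completedLaurentLoc_and_powerSeriesOL
    (p : ℕ) [Fact p.Prime]
    (S : Type) [CommRing S] [IsDomain S] [IsNoetherianRing S] [CharZero S]
    (hcomp : IsAdicComplete (Ideal.span {(p : S)}) S)
    (hp0 : (p : S) ≠ 0)
    [hP : (Ideal.span {(p : S)}).IsPrime]
    -- the natural maps between the rings in play, each characterized by its values on
    -- the evident dense subring:
    -- `ab : S⟦t⟧[1/p] → S((t))^∧_(p)[1/p]`
    (ab : PSLoc p S →+* LSLoc p S)
    (hab : ∀ f : PowerSeries S,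
      ab (algebraMap (PowerSeries S) (PSLoc p S) f) =
        algebraMap (PCLS p S) (LSLoc p S)
          (algebraMap (LaurentSeries S) (PCLS p S) (HahnSeries.ofPowerSeries ℤ S f)))
    -- `aC : S⟦t⟧[1/p] → 𝔬_L⟦t⟧[1/p]`, induced by the canonical map `S → 𝔬_L`
    (aC : PSLoc p S →+* PSLoc p (OL p S))
    (haC : ∀ f : PowerSeries S,
      aC (algebraMap (PowerSeries S) (PSLoc p S) f) =
        algebraMap (PowerSeries (OL p S)) (PSLoc p (OL p S))
          (PowerSeries.map
            ((algebraMap (Localization.AtPrime (Ideal.span {(p : S)})) (OL p S)).comp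
              (algebraMap S (Localization.AtPrime (Ideal.span {(p : S)})))) f))
    -- `cD : 𝔬_L⟦t⟧[1/p] → 𝔬_L((t))^∧_(p)[1/p]`
    (cD : PSLoc p (OL p S) →+* LSLoc p (OL p S))
    (hcD : ∀ g : PowerSeries (OL p S),
      cD (algebraMap (PowerSeries (OL p S)) (PSLoc p (OL p S)) g) =
        algebraMap (PCLS p (OL p S)) (LSLoc p (OL p S))
          (algebraMap (LaurentSeries (OL p S)) (PCLS p (OL p S))
            (HahnSeries.ofPowerSeries ℤ (OL p S) g)))
    -- the coefficientwise map `S((t)) → 𝔬_L((t))`, its extension `θ` to `p`-adic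
    -- completions, and the induced map `bD : S((t))^∧_(p)[1/p] → 𝔬_L((t))^∧_(p)[1/p]`
    (ψ : LaurentSeries S →+* LaurentSeries (OL p S))
    (hψ : ∀ (x : LaurentSeries S) (n : ℤ),
      (ψ x).coeff n =
        (algebraMap (Localization.AtPrime (Ideal.span {(p : S)})) (OL p S))
          (algebraMap S (Localization.AtPrime (Ideal.span {(p : S)})) (x.coeff n)))
    (θ : PCLS p S →+* PCLS p (OL p S))
    (hθ : ∀ x : LaurentSeries S,
      θ (algebraMap (LaurentSeries S) (PCLS p S) x) =
        algebraMap (LaurentSeries (OL p S)) (PCLS p (OL p S)) (ψ x))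
    (bD : LSLoc p S →+* LSLoc p (OL p S))
    (hbD : ∀ x : PCLS p S,
      bD (algebraMap (PCLS p S) (LSLoc p S) x) =
        algebraMap (PCLS p (OL p S)) (LSLoc p (OL p S)) (θ x))
    -- the two composites `S⟦t⟧[1/p] → 𝔬_L((t))^∧_(p)[1/p]` agree
    (hsquare : cD.comp aC = bD.comp ab) :
    -- then, inside `𝔬_L((t))^∧_(p)[1/p]`, the intersection of the images of
    -- `S((t))^∧_(p)[1/p]` and of `𝔬_L⟦t⟧[1/p]` is exactly the image of `S⟦t⟧[1/p]`
    (bD.range ⊓ cD.range : Subring (LSLoc p (OL p S))) = (cD.comp aC).range := by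
  have hprime : Prime (p : S) := (Ideal.span_singleton_prime hp0).mp hP
  set ι : S →+* OL p S := (algebraMap (Localization.AtPrime (Ideal.span {(p : S)})) (OL p S)).comp
    (algebraMap S (Localization.AtPrime (Ideal.span {(p : S)})))
  have hι (n : ℕ) (r : S) (h : (p : OL p S) ^ n ∣ ι r) : (p : S) ^ n ∣ r := by
    have h' := AdicCompletion.cast_pow_dvd_of_cast_pow_dvd_algebraMap h
    rw [← map_natCast (algebraMap S (Localization.AtPrime (Ideal.span {(p : S)})))] at h'
    exact IsLocalization.AtPrime.pow_dvd_of_pow_dvd_algebraMap hprime h'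
  apply le_antisymm
  · rintro y ⟨⟨u, hu⟩, ⟨v, hv⟩⟩
    obtain ⟨a, x, hx⟩ := IsLocalization.Away.surj (p : PCLS p S) u
    obtain ⟨b, g, hg⟩ := IsLocalization.Away.surj (p : PowerSeries (OL p S)) v
    have hx' := congrArg bD hx
    have hg' := congrArg cD hg
    rw [map_natCast, map_mul, map_pow, map_natCast, hu, hbD] at hx'
    rw [map_natCast, map_mul, map_pow, map_natCast, hv, hcD] at hg'
    obtain ⟨⟨_, c, rfl⟩, hc⟩ := (IsLocalization.eq_iff_exists
      (Submonoid.powers (p : PCLS p (OL p S))) (LSLoc p (OL p S))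
      (x := (p : PCLS p (OL p S)) ^ b * θ x)
      (y := (p : PCLS p (OL p S)) ^ a * algebraMap (LaurentSeries (OL p S)) _
        (HahnSeries.ofPowerSeries ℤ (OL p S) g))).mp (by
          rw [map_mul, map_mul, map_pow, map_pow, map_natCast, ← hx', ← hg']
          ring)
    set g₁ : PowerSeries (OL p S) := (p : PowerSeries (OL p S)) ^ (c + a) * g with hg₁
    have hθg : θ ((p : PCLS p S) ^ (c + b) * x) =
        algebraMap (LaurentSeries (OL p S)) (PCLS p (OL p S))
          (HahnSeries.ofPowerSeries ℤ (OL p S) g₁) := by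
      rw [hg₁, map_mul, map_mul, map_mul]
      simp only [map_pow, map_natCast]
      rw [pow_add, pow_add, mul_assoc, mul_assoc]
      exact hc
    have hlift (k : ℕ) : ∃ r, ι r = PowerSeries.coeff k g₁ := by
      refine hcomp.toIsPrecomplete.exists_map_eq_of_forall_cast_pow_dvd ι hι
        (fun _ => AdicCompletion.eq_zero_of_forall_cast_pow_dvd) fun n => ?_
      obtain ⟨z, hz⟩ := AdicCompletion.exists_cast_pow_dvd_sub_algebraMap
        ((p : PCLS p S) ^ (c + b) * x) n
      have hz' := map_dvd θ hz
      rw [map_pow, map_natCast, map_sub, hθg, hθ, ← map_sub] at hz'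
      have h := HahnSeries.cast_pow_dvd_coeff
        (AdicCompletion.cast_pow_dvd_of_cast_pow_dvd_algebraMap hz') (k : ℤ)
      rw [HahnSeries.coeff_sub, hψ, HahnSeries.ofPowerSeries_apply_coeff] at h
      exact ⟨z.coeff k, h⟩
    choose f hf using hlift
    have hmap : PowerSeries.map ι (PowerSeries.mk f) = g₁ := by
      ext k
      rw [PowerSeries.coeff_map, PowerSeries.coeff_mk, hf]
    have hunit : IsUnit (p : PSLoc p S) := by
      simpa using IsLocalization.Away.algebraMap_isUnit (S := PSLoc p S) (p : PowerSeries S)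
    obtain ⟨w, hw⟩ := hunit.pow (c + a + b)
    have hw' : (p : LSLoc p (OL p S)) ^ (c + a + b) * (cD.comp aC) (↑w⁻¹ : PSLoc p S) = 1 := by
      have h := congrArg (cD.comp aC) w.mul_inv
      rwa [hw, map_mul, map_pow, map_natCast, map_one] at h
    refine ⟨algebraMap _ _ (PowerSeries.mk f) * ↑w⁻¹, ?_⟩
    rw [map_mul, RingHom.comp_apply, haC, hmap, hcD, hg₁]
    simp only [map_mul, map_pow, map_natCast]
    rw [← hg']
    linear_combination y * hw'
  · rintro _ ⟨x, rfl⟩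
    exact ⟨⟨ab x, (DFunLike.congr_fun hsquare x).symm⟩, ⟨aC x, rfl⟩⟩
end

section
/- Let S be a Noetherian integral domain of characteristic zero which is p-adically complete, in which p ≠ 0 and the principal ideal pS is prime, and let 𝔬_L denote the p-adic completion of the localization of S at the prime ideal pS. Let M be a finite projective S⟦t⟧[1/p]-module. Then, inside M ⊗_{S⟦t⟧} 𝔬_L((t))^∧_(p), one has (M ⊗_{S⟦t⟧} S((t))^∧_(p)) ∩ (M ⊗_{S⟦t⟧} 𝔬_L⟦t⟧) = M; that is, an element of M ⊗_{S⟦t⟧} 𝔬_L((t))^∧_(p) lying in the images of both M ⊗_{S⟦t⟧} S((t))^∧_(p) and M ⊗_{S⟦t⟧} 𝔬_L⟦t⟧ lies in the image of M. -/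
/-!
Statement 8: Let `S` be a Noetherian integral domain of characteristic zero which is
`p`-adically complete, with `p ≠ 0` and `pS` prime, and let `𝔬_L` be the `p`-adic
completion of the localization of `S` at `pS`.  Let `M` be a finite projective
`S⟦t⟧[1/p]`-module.  Then, inside `M ⊗_{S⟦t⟧} 𝔬_L((t))^∧_(p)`, one has
`(M ⊗_{S⟦t⟧} S((t))^∧_(p)) ∩ (M ⊗_{S⟦t⟧} 𝔬_L⟦t⟧) = M`.
-/

open PowerSeries
open scoped TensorProduct

namespace AdicCompletion

/-- An element of the completion at a principal ideal agrees with an element of the base ring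
up to any prescribed power of the generator. -/
theorem exists_eq_algebraMap_add_pow_mul {R : Type*} [CommRing R] (a : R) (n : ℕ)
    (x : AdicCompletion (Ideal.span {a}) R) :
    ∃ (r : R) (y : AdicCompletion (Ideal.span {a}) R),
      x = algebraMap R _ r + algebraMap R _ a ^ n * y := by
  obtain ⟨r, hr⟩ := Submodule.Quotient.mk_surjective _ (x.val n)
  have hfg : (Ideal.span {a}).FG := ⟨{a}, by simp⟩
  have hker : x - algebraMap R _ r ∈ (eval (Ideal.span {a}) R n).ker := by
    rw [LinearMap.mem_ker, map_sub, eval_apply, eval_apply, sub_eq_zero, ← hr]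
    rfl
  rw [← pow_smul_top_eq_ker_eval hfg, Ideal.span_singleton_pow,
    Submodule.ideal_span_singleton_smul] at hker
  obtain ⟨y, -, hy⟩ := hker
  refine ⟨r, y, ?_⟩
  rw [← map_pow, ← Algebra.smul_def]
  exact eq_add_of_sub_eq' hy.symm

/-- If the image of `r` in the completion at `(a)` is divisible by `a ^ n`, then so is `r`. -/
theorem pow_dvd_of_algebraMap_eq {R : Type*} [CommRing R] {a r : R} {n : ℕ}
    {y : AdicCompletion (Ideal.span {a}) R}
    (h : algebraMap R (AdicCompletion (Ideal.span {a}) R) r = algebraMap R _ a ^ n * y) :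
    a ^ n ∣ r := by
  have h' := congrArg (evalₐ (Ideal.span {a}) n) h
  rw [← map_pow, map_mul, AlgHom.commutes, AlgHom.commutes, Ideal.Quotient.algebraMap_eq,
    Ideal.Quotient.eq_zero_iff_mem.mpr
      (Ideal.pow_mem_pow (Ideal.mem_span_singleton_self a) n), zero_mul,
    Ideal.Quotient.eq_zero_iff_mem, Ideal.span_singleton_pow, Ideal.mem_span_singleton] at h'
  exact h'

/-- The completion at a principal ideal `(a)` is `a`-adically separated. -/
theorem eq_zero_of_forall_pow_dvd {R : Type*} [CommRing R] {a : R}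
    {x : AdicCompletion (Ideal.span {a}) R}
    (h : ∀ n, algebraMap R (AdicCompletion (Ideal.span {a}) R) a ^ n ∣ x) : x = 0 := by
  refine ext_evalₐ fun n ↦ ?_
  obtain ⟨y, rfl⟩ := h n
  rw [← map_pow, map_mul, AlgHom.commutes, Ideal.Quotient.algebraMap_eq,
    Ideal.Quotient.eq_zero_iff_mem.mpr
      (Ideal.pow_mem_pow (Ideal.mem_span_singleton_self a) n), zero_mul,
    _root_.map_zero]

end AdicCompletion

/-- Divisibility by a power of a prime element can be tested in the localization at that prime. -/
theorem Prime.pow_dvd_of_pow_dvd_algebraMap_localization {S : Type*} [CommRing S] [IsDomain S]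
    {a : S} (ha : Prime a) [(Ideal.span {a}).IsPrime] {s : S} {n : ℕ}
    (h : algebraMap S (Localization.AtPrime (Ideal.span {a})) a ^ n ∣ algebraMap S _ s) :
    a ^ n ∣ s := by
  obtain ⟨y, hy⟩ := h
  obtain ⟨⟨u, v⟩, huv⟩ := IsLocalization.surj (Ideal.span {a}).primeCompl y
  have hinj := IsLocalization.injective (Localization.AtPrime (Ideal.span {a}))
    (Ideal.span {a}).primeCompl_le_nonZeroDivisors
  have key : s * v = a ^ n * u := hinj (by
    rw [map_mul, map_mul, map_pow, hy, mul_assoc, huv])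
  refine ha.pow_dvd_of_dvd_mul_right n (fun hv ↦ v.2 ?_) (Dvd.intro u key.symm)
  exact Ideal.mem_span_singleton.mpr hv

/-- An element of the completed localization at a prime element `a` that is `a`-adically
approximated by elements of the `a`-adically complete domain `S` comes from `S`. -/
theorem exists_algebraMap_eq_of_forall_approx {S : Type*} [CommRing S] [IsDomain S] {a : S}
    (ha : Prime a) [(Ideal.span {a}).IsPrime] [IsAdicComplete (Ideal.span {a}) S]
    {b : Localization.AtPrime (Ideal.span {a})} (hb : b = algebraMap S _ a)
    (c : AdicCompletion (Ideal.span {b}) (Localization.AtPrime (Ideal.span {a})))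
    (h : ∀ n : ℕ, ∃ s : S, algebraMap _ (AdicCompletion (Ideal.span {b}) _) b ^ n ∣
      c - algebraMap (Localization.AtPrime (Ideal.span {a})) _ (algebraMap S _ s)) :
    ∃ s : S, algebraMap (Localization.AtPrime (Ideal.span {a})) _ (algebraMap S _ s) = c := by
  choose f hf using h
  have hcauchy : ∀ {m n}, m ≤ n →
      f m ≡ f n [SMOD (Ideal.span {a} ^ m • ⊤ : Submodule S S)] := by
    intro m n hmn
    rw [SModEq.sub_mem, smul_eq_mul, Ideal.mul_top, Ideal.span_singleton_pow,
      Ideal.mem_span_singleton]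
    apply ha.pow_dvd_of_pow_dvd_algebraMap_localization
    obtain ⟨y, hy⟩ := dvd_sub ((pow_dvd_pow _ hmn).trans (hf n)) (hf m)
    rw [← hb]
    apply AdicCompletion.pow_dvd_of_algebraMap_eq (y := y)
    rw [← hy, map_sub, map_sub]
    ring
  obtain ⟨s, hs⟩ := IsPrecomplete.prec' f hcauchy
  refine ⟨s, (sub_eq_zero.mp (AdicCompletion.eq_zero_of_forall_pow_dvd fun n ↦ ?_)).symm⟩
  have hsn := hs n
  rw [SModEq.sub_mem, smul_eq_mul, Ideal.mul_top, Ideal.span_singleton_pow,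
    Ideal.mem_span_singleton] at hsn
  obtain ⟨w, hw⟩ := hsn
  have hdvd : algebraMap _ (AdicCompletion (Ideal.span {b}) (Localization.AtPrime
      (Ideal.span {a}))) b ^ n ∣ algebraMap (Localization.AtPrime (Ideal.span {a})) _
        (algebraMap S _ (f n - s)) := by
    rw [hw, map_mul, map_mul, map_pow, map_pow, ← hb]
    exact dvd_mul_right _ _
  have hsum := dvd_add (hf n) hdvd
  rwa [map_sub, map_sub, sub_add_sub_cancel] at hsum

section Tensor

variable {A M B C D : Type*} [CommRing A] [AddCommGroup M] [Module A M]
  [CommRing B] [Algebra A B] [CommRing C] [Algebra A C] [CommRing D] [Algebra A D]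

/-- Contraction of the first tensor factor by a linear form. -/
noncomputable def dualContraction (B : Type*) [CommRing B] [Algebra A B] (φ : M →ₗ[A] A) :
    M ⊗[A] B →ₗ[A] B :=
  (TensorProduct.lid A B).toLinearMap ∘ₗ φ.rTensor B

@[simp]
theorem dualContraction_tmul (φ : M →ₗ[A] A) (m : M) (x : B) :
    dualContraction B φ (m ⊗ₜ x) = φ m • x := by
  simp [dualContraction]

theorem dualContraction_baseChange (φ : M →ₗ[A] A) (g : B →+* D)
    (hg : ∀ a, g (algebraMap A B a) = algebraMap A D a) (T : M ⊗[A] B → M ⊗[A] D)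
    (hadd : ∀ u v, T (u + v) = T u + T v) (hT : ∀ m x, T (m ⊗ₜ x) = m ⊗ₜ g x)
    (u : M ⊗[A] B) : dualContraction D φ (T u) = g (dualContraction B φ u) := by
  induction u with
  | zero =>
    have hzero : T 0 = 0 := by simpa using hadd 0 0
    simp [hzero]
  | tmul m x => simp [hT, Algebra.smul_def, hg]
  | add u v hu hv => rw [hadd, map_add, hu, hv, map_add, map_add]

/-- For a finite projective module, an intersection property of subrings passes to the
base-changed modules. -/
theorem Module.Projective.exists_tmul_one_eq_of_inter [Module.Finite A M] [Module.Projective A M]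
    (b : B →+* D) (hb : ∀ a, b (algebraMap A B a) = algebraMap A D a)
    (c : C →+* D) (hc : ∀ a, c (algebraMap A C a) = algebraMap A D a)
    (hinter : ∀ x y, b x = c y → ∃ a, algebraMap A D a = c y)
    (TB : M ⊗[A] B → M ⊗[A] D) (hTBadd : ∀ u v, TB (u + v) = TB u + TB v)
    (hTB : ∀ m x, TB (m ⊗ₜ x) = m ⊗ₜ b x)
    (TC : M ⊗[A] C → M ⊗[A] D) (hTCadd : ∀ u v, TC (u + v) = TC u + TC v)
    (hTC : ∀ m x, TC (m ⊗ₜ x) = m ⊗ₜ c x)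
    {u : M ⊗[A] B} {v : M ⊗[A] C} (huv : TB u = TC v) :
    ∃ m : M, m ⊗ₜ (1 : D) = TC v := by
  obtain ⟨n, f, g, -, -, hfg⟩ := Module.Finite.exists_comp_eq_id_of_projective A M
  let φ : Fin n → M →ₗ[A] A := fun k ↦ LinearMap.proj k ∘ₗ g
  let x : Fin n → M := fun k ↦ f (Pi.single k 1)
  have hdual : ∀ m : M, ∑ k, φ k m • x k = m := fun m ↦ by
    conv_rhs => rw [← LinearMap.id_apply (R := A) m, ← hfg, LinearMap.comp_apply,
      pi_eq_sum_univ' (g m), map_sum]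
    refine Finset.sum_congr rfl fun k _ ↦ ?_
    rw [map_smul]
    congr 2
  have hexpand : ∀ z : M ⊗[A] D, ∑ k, x k ⊗ₜ[A] dualContraction D (φ k) z = z := fun z ↦ by
    induction z with
    | zero => simp
    | tmul m d =>
      conv_rhs => rw [← hdual m, TensorProduct.sum_tmul]
      simp [TensorProduct.smul_tmul]
    | add z w hz hw => simp only [map_add, TensorProduct.tmul_add, Finset.sum_add_distrib, hz, hw]
  have hcoord : ∀ k, ∃ a, algebraMap A D a = dualContraction D (φ k) (TC v) := fun k ↦ by
    have hB := dualContraction_baseChange (φ k) b hb TB hTBadd hTB u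
    have hC := dualContraction_baseChange (φ k) c hc TC hTCadd hTC v
    rw [huv] at hB
    rw [hC]
    exact hinter _ _ (hB.symm.trans hC)
  choose a ha using hcoord
  refine ⟨∑ k, a k • x k, ?_⟩
  rw [← hexpand (TC v), TensorProduct.sum_tmul]
  refine Finset.sum_congr rfl fun k _ ↦ ?_
  rw [TensorProduct.smul_tmul, ← ha k, Algebra.algebraMap_eq_smul_one]

end Tensor

section LaurentSeries

theorem LaurentSeries.coeff_natCast_pow_mul {R : Type*} [CommRing R] (p n : ℕ)
    (y : LaurentSeries R) (i : ℤ) :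
    ((p : LaurentSeries R) ^ n * y).coeff i = (p : R) ^ n * y.coeff i := by
  rw [← Nat.cast_pow, ← nsmul_eq_mul, HahnSeries.coeff_nsmul, Pi.smul_apply, nsmul_eq_mul,
    Nat.cast_pow]

/-- A power series over `T` that is `p`-adically a limit of Laurent series over `S` has
coefficients approximated by elements of `S`. -/
theorem exists_coeff_approx {p : ℕ} {S T : Type} [CommRing S] [CommRing T] (j : S →+* T)
    (ψ : LaurentSeries S →+* LaurentSeries T) (hψ : ∀ x n, (ψ x).coeff n = j (x.coeff n))
    (θ : PCLS p S →+* PCLS p T)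
    (hθ : ∀ x, θ (algebraMap (LaurentSeries S) (PCLS p S) x) =
      algebraMap (LaurentSeries T) (PCLS p T) (ψ x))
    (x : PCLS p S) (y : PowerSeries T)
    (hxy : θ x = algebraMap (LaurentSeries T) (PCLS p T) (HahnSeries.ofPowerSeries ℤ T y))
    (i n : ℕ) : ∃ s : S, (p : T) ^ n ∣ PowerSeries.coeff i y - j s := by
  obtain ⟨r, w, rfl⟩ := AdicCompletion.exists_eq_algebraMap_add_pow_mul _ n x
  rw [map_add, hθ, map_mul, map_pow, map_natCast, map_natCast] at hxy
  have hsub : algebraMap (LaurentSeries T) (PCLS p T) (HahnSeries.ofPowerSeries ℤ T y - ψ r) =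
      algebraMap (LaurentSeries T) (PCLS p T) (p : LaurentSeries T) ^ n * θ w := by
    rw [map_sub, ← hxy, map_natCast]
    ring
  obtain ⟨v, hv⟩ := AdicCompletion.pow_dvd_of_algebraMap_eq hsub
  refine ⟨r.coeff i, v.coeff i, ?_⟩
  rw [← LaurentSeries.coeff_natCast_pow_mul, ← hv, HahnSeries.coeff_sub, hψ,
    HahnSeries.ofPowerSeries_apply_coeff]

end LaurentSeries

theorem Localization.Away.exists_pow_mul_eq {R : Type*} [CommRing R] (p : ℕ)
    (x : Localization.Away (p : R)) :
    ∃ (n : ℕ) (r : R), (p : Localization.Away (p : R)) ^ n * x = algebraMap R _ r := by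
  obtain ⟨n, r, hr⟩ := IsLocalization.Away.surj (p : R) x
  exact ⟨n, r, by rw [← hr, map_natCast, mul_comm]⟩

theorem Localization.Away.isUnit_natCast (R : Type*) [CommRing R] (p : ℕ) :
    IsUnit (p : Localization.Away (p : R)) := by
  simpa using IsLocalization.Away.algebraMap_isUnit (S := Localization.Away (p : R)) (p : R)

set_option maxHeartbeats 2000000 in
theorem tensor_inter_tensor_eq_self
    (p : ℕ) [Fact p.Prime]
    (S : Type) [CommRing S] [IsDomain S] [IsNoetherianRing S] [CharZero S]
    (hcomp : IsAdicComplete (Ideal.span {(p : S)}) S)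
    (hp0 : (p : S) ≠ 0)
    [hP : (Ideal.span {(p : S)}).IsPrime]
    -- the natural maps between the rings in play, each characterized by its values on
    -- the evident dense subring:
    -- `ab : S⟦t⟧[1/p] → S((t))^∧_(p)[1/p]`
    (ab : PSLoc p S →+* LSLoc p S)
    (hab : ∀ f : PowerSeries S,
      ab (algebraMap (PowerSeries S) (PSLoc p S) f) =
        algebraMap (PCLS p S) (LSLoc p S)
          (algebraMap (LaurentSeries S) (PCLS p S) (HahnSeries.ofPowerSeries ℤ S f)))
    -- `aC : S⟦t⟧[1/p] → 𝔬_L⟦t⟧[1/p]`, induced by the canonical map `S → 𝔬_L`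
    (aC : PSLoc p S →+* PSLoc p (OL p S))
    (haC : ∀ f : PowerSeries S,
      aC (algebraMap (PowerSeries S) (PSLoc p S) f) =
        algebraMap (PowerSeries (OL p S)) (PSLoc p (OL p S))
          (PowerSeries.map
            ((algebraMap (Localization.AtPrime (Ideal.span {(p : S)})) (OL p S)).comp
              (algebraMap S (Localization.AtPrime (Ideal.span {(p : S)})))) f))
    -- `cD : 𝔬_L⟦t⟧[1/p] → 𝔬_L((t))^∧_(p)[1/p]`
    (cD : PSLoc p (OL p S) →+* LSLoc p (OL p S))
    (hcD : ∀ g : PowerSeries (OL p S),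
      cD (algebraMap (PowerSeries (OL p S)) (PSLoc p (OL p S)) g) =
        algebraMap (PCLS p (OL p S)) (LSLoc p (OL p S))
          (algebraMap (LaurentSeries (OL p S)) (PCLS p (OL p S))
            (HahnSeries.ofPowerSeries ℤ (OL p S) g)))
    -- the coefficientwise map `S((t)) → 𝔬_L((t))`, its extension `θ` to `p`-adic
    -- completions, and the induced map `bD : S((t))^∧_(p)[1/p] → 𝔬_L((t))^∧_(p)[1/p]`
    (ψ : LaurentSeries S →+* LaurentSeries (OL p S))
    (hψ : ∀ (x : LaurentSeries S) (n : ℤ),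
      (ψ x).coeff n =
        (algebraMap (Localization.AtPrime (Ideal.span {(p : S)})) (OL p S))
          (algebraMap S (Localization.AtPrime (Ideal.span {(p : S)})) (x.coeff n)))
    (θ : PCLS p S →+* PCLS p (OL p S))
    (hθ : ∀ x : LaurentSeries S,
      θ (algebraMap (LaurentSeries S) (PCLS p S) x) =
        algebraMap (LaurentSeries (OL p S)) (PCLS p (OL p S)) (ψ x))
    (bD : LSLoc p S →+* LSLoc p (OL p S))
    (hbD : ∀ x : PCLS p S,
      bD (algebraMap (PCLS p S) (LSLoc p S) x) =
        algebraMap (PCLS p (OL p S)) (LSLoc p (OL p S)) (θ x))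
    -- the two composites `S⟦t⟧[1/p] → 𝔬_L((t))^∧_(p)[1/p]` agree
    (hsquare : cD.comp aC = bD.comp ab)
    -- we regard the three target rings as algebras over `A := S⟦t⟧[1/p]` via the above
    -- maps
    [instB : Algebra (PSLoc p S) (LSLoc p S)]
    (hinstB : algebraMap (PSLoc p S) (LSLoc p S) = ab)
    [instC : Algebra (PSLoc p S) (PSLoc p (OL p S))]
    (hinstC : algebraMap (PSLoc p S) (PSLoc p (OL p S)) = aC)
    [instD : Algebra (PSLoc p S) (LSLoc p (OL p S))]
    (hinstD : algebraMap (PSLoc p S) (LSLoc p (OL p S)) = cD.comp aC)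
    -- a finite projective module `M` over `A = S⟦t⟧[1/p]`
    (M : Type) [AddCommGroup M] [Module (PSLoc p S) M]
    [Module.Finite (PSLoc p S) M] [Module.Projective (PSLoc p S) M]
    -- the natural maps `M ⊗ S((t))^∧_(p)[1/p] → M ⊗ 𝔬_L((t))^∧_(p)[1/p]` and
    -- `M ⊗ 𝔬_L⟦t⟧[1/p] → M ⊗ 𝔬_L((t))^∧_(p)[1/p]`, characterized on pure tensors
    (TB : M ⊗[PSLoc p S] (LSLoc p S) → M ⊗[PSLoc p S] (LSLoc p (OL p S)))
    (hTBadd : ∀ u v, TB (u + v) = TB u + TB v)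
    (hTB : ∀ (m : M) (x : LSLoc p S), TB (m ⊗ₜ x) = m ⊗ₜ bD x)
    (TC : M ⊗[PSLoc p S] (PSLoc p (OL p S)) → M ⊗[PSLoc p S] (LSLoc p (OL p S)))
    (hTCadd : ∀ u v, TC (u + v) = TC u + TC v)
    (hTC : ∀ (m : M) (x : PSLoc p (OL p S)), TC (m ⊗ₜ x) = m ⊗ₜ cD x) :
    -- then an element of `M ⊗ 𝔬_L((t))^∧_(p)[1/p]` lying in the image of both
    -- `M ⊗ S((t))^∧_(p)[1/p]` and `M ⊗ 𝔬_L⟦t⟧[1/p]` lies in the image of `M`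
    ∀ z : M ⊗[PSLoc p S] (LSLoc p (OL p S)),
      (∃ u, TB u = z) → (∃ v, TC v = z) →
      ∃ m : M, m ⊗ₜ (1 : LSLoc p (OL p S)) = z := by
  rintro _ ⟨u, hu⟩ ⟨v, rfl⟩
  have hprime : Prime (p : S) := (Ideal.span_singleton_prime hp0).mp hP
  refine Module.Projective.exists_tmul_one_eq_of_inter bD
    (fun a ↦ by rw [hinstB, hinstD, hsquare]; rfl) cD (fun a ↦ by rw [hinstC, hinstD]; rfl)
    ?_ TB hTBadd hTB TC hTCadd hTC hu
  intro x y hxy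
  obtain ⟨n, b, hb⟩ := Localization.Away.exists_pow_mul_eq p x
  obtain ⟨m, c, hc⟩ := Localization.Away.exists_pow_mul_eq p y
  have hloc : algebraMap (PCLS p (OL p S)) (LSLoc p (OL p S)) (θ ((p : PCLS p S) ^ m * b)) =
      algebraMap (PCLS p (OL p S)) (LSLoc p (OL p S))
        (algebraMap (LaurentSeries (OL p S)) (PCLS p (OL p S))
          (HahnSeries.ofPowerSeries ℤ (OL p S) ((p : PowerSeries (OL p S)) ^ n * c))) := by
    rw [← hbD, ← hcD, map_mul, map_mul (algebraMap (PowerSeries (OL p S)) _), ← hb, ← hc]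
    simp only [map_mul, map_pow, map_natCast]
    rw [hxy]
    ring
  obtain ⟨⟨_, k, rfl⟩, hk⟩ := (IsLocalization.eq_iff_exists
    (Submonoid.powers (p : PCLS p (OL p S))) (LSLoc p (OL p S))).mp hloc
  have hint : θ ((p : PCLS p S) ^ k * ((p : PCLS p S) ^ m * b)) =
      algebraMap (LaurentSeries (OL p S)) (PCLS p (OL p S))
        (HahnSeries.ofPowerSeries ℤ (OL p S)
          ((p : PowerSeries (OL p S)) ^ k * ((p : PowerSeries (OL p S)) ^ n * c))) := by
    rw [map_mul θ, map_mul (HahnSeries.ofPowerSeries ℤ (OL p S)) (_ ^ k), map_mul (algebraMap _ _)]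
    simpa only [map_pow, map_natCast] using hk
  have hcoeff := fun i ↦ exists_algebraMap_eq_of_forall_approx hprime
    (b := (p : Localization.AtPrime (Ideal.span {(p : S)}))) (map_natCast _ p).symm
    _ (fun l ↦ by
      simpa only [map_natCast, RingHom.comp_apply] using exists_coeff_approx
        ((algebraMap (Localization.AtPrime (Ideal.span {(p : S)})) (OL p S)).comp
          (algebraMap S (Localization.AtPrime (Ideal.span {(p : S)})))) ψ hψ θ hθ _ _ hint i l)
  choose s hs using hcoeff
  obtain ⟨w, hw⟩ := (Localization.Away.isUnit_natCast (PowerSeries S) p).pow (k + (n + m))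
  have hunit := (Localization.Away.isUnit_natCast (PowerSeries (OL p S)) p).pow (k + (n + m))
  refine ⟨↑w⁻¹ * algebraMap (PowerSeries S) (PSLoc p S) (PowerSeries.mk s), ?_⟩
  rw [hinstD, RingHom.comp_apply]
  congr 1
  apply hunit.mul_left_cancel
  have hcancel : (p : PSLoc p (OL p S)) ^ (k + (n + m)) * aC ↑w⁻¹ = 1 := by
    rw [← map_natCast aC, ← map_pow, ← hw, ← map_mul, Units.mul_inv, map_one]
  rw [map_mul, ← mul_assoc, hcancel, one_mul, haC, pow_add, pow_add, mul_assoc, mul_assoc, hc]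
  rw [← map_natCast (algebraMap (PowerSeries (OL p S)) (PSLoc p (OL p S))), ← map_pow, ← map_pow,
    ← map_mul, ← map_mul]
  congr 1
  refine PowerSeries.ext fun i ↦ ?_
  rw [PowerSeries.coeff_map, PowerSeries.coeff_mk]
  exact hs i
end
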